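/- The following all hold: (i) for every integer a ≥ 2 there exists a type-2 configuration of [a,1,1] whose contact graph admits no proper 4-coloring; (ii) for every integer a ≥ 5 there exists a type-2 configuration of [a,1,1] whose contact graph admits no proper 5-coloring; (iii) there exists a type-2 configuration of [4,2,1] whose contact graph admits no proper 5-coloring. -/

import Mathlib

/-- A cuboid with integer root and integer dimensions. -/
structure Cuboid where
  root : ℤ × ℤ × ℤ
  dims : ℤ × ℤ × ℤ
deriving DecidableEq

namespace Cuboid

/-- The dimensions are positive. -/
def valid (C : Cuboid) : Prop :=
  0 < C.dims.1 ∧ 0 < C.dims.2.1 ∧ 0 < C.dims.2.2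

/-- The closed cuboid `[x,x+a] × [y,y+b] × [z,z+c] ⊆ ℝ³`. -/
def toSet (C : Cuboid) : Set (ℝ × ℝ × ℝ) :=
  {p | (C.root.1 : ℝ) ≤ p.1 ∧ p.1 ≤ C.root.1 + C.dims.1 ∧
       (C.root.2.1 : ℝ) ≤ p.2.1 ∧ p.2.1 ≤ C.root.2.1 + C.dims.2.1 ∧
       (C.root.2.2 : ℝ) ≤ p.2.2 ∧ p.2.2 ≤ C.root.2.2 + C.dims.2.2}

/-- The open cuboid `(x,x+a) × (y,y+b) × (z,z+c) ⊆ ℝ³` (the interior). -/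
def inte (C : Cuboid) : Set (ℝ × ℝ × ℝ) :=
  {p | (C.root.1 : ℝ) < p.1 ∧ p.1 < C.root.1 + C.dims.1 ∧
       (C.root.2.1 : ℝ) < p.2.1 ∧ p.2.1 < C.root.2.1 + C.dims.2.1 ∧
       (C.root.2.2 : ℝ) < p.2.2 ∧ p.2.2 < C.root.2.2 + C.dims.2.2}

/-- The set `(ℤ×ℤ×ℝ) ∪ (ℤ×ℝ×ℤ) ∪ (ℝ×ℤ×ℤ)` of grid lines. -/
def grid : Set (ℝ × ℝ × ℝ) :=
  {p | ((∃ m : ℤ, p.1 = m) ∧ (∃ n : ℤ, p.2.1 = n)) ∨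
       ((∃ m : ℤ, p.1 = m) ∧ (∃ n : ℤ, p.2.2 = n)) ∨
       ((∃ m : ℤ, p.2.1 = m) ∧ (∃ n : ℤ, p.2.2 = n))}

/-- Two cuboids collide when their interiors intersect. -/
def Collide (C D : Cuboid) : Prop := (C.inte ∩ D.inte).Nonempty

/-- Two cuboids touch when their interiors are disjoint but their intersection
contains a point outside the grid lines (i.e. it is a non-degenerate rectangle). -/
def Touch (C D : Cuboid) : Prop :=
  ¬ Collide C D ∧ ∃ p ∈ C.toSet ∩ D.toSet, p ∉ grid

end Cuboid

/-- A configuration: a finite family of valid pairwise non-colliding cuboids. -/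
def IsConfig (F : Finset Cuboid) : Prop :=
  (∀ C ∈ F, C.valid) ∧ ∀ C ∈ F, ∀ D ∈ F, C ≠ D → ¬ Cuboid.Collide C D

/-- A type-1 configuration of `[a,b,c]`: every cuboid has dimensions exactly `(a,b,c)`. -/
def Type1 (a b c : ℕ) (F : Finset Cuboid) : Prop :=
  ∀ C ∈ F, C.dims = ((a : ℤ), (b : ℤ), (c : ℤ))

/-- A type-2 configuration of `[a,b,c]`: every cuboid has dimensions `(a,b,c)` or `(b,a,c)`. -/
def Type2 (a b c : ℕ) (F : Finset Cuboid) : Prop :=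
  ∀ C ∈ F, C.dims = ((a : ℤ), (b : ℤ), (c : ℤ)) ∨ C.dims = ((b : ℤ), (a : ℤ), (c : ℤ))

/-- A type-3 configuration of `[a,b,c]`: every cuboid's dimensions are a permutation of `(a,b,c)`. -/
def Type3 (a b c : ℕ) (F : Finset Cuboid) : Prop :=
  ∀ C ∈ F, C.dims = ((a : ℤ), (b : ℤ), (c : ℤ)) ∨ C.dims = ((a : ℤ), (c : ℤ), (b : ℤ)) ∨
    C.dims = ((b : ℤ), (a : ℤ), (c : ℤ)) ∨ C.dims = ((b : ℤ), (c : ℤ), (a : ℤ)) ∨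
    C.dims = ((c : ℤ), (a : ℤ), (b : ℤ)) ∨ C.dims = ((c : ℤ), (b : ℤ), (a : ℤ))

/-- A proper `k`-coloring of a configuration: touching cuboids get distinct colors. -/
def ProperColoring (k : ℕ) (F : Finset Cuboid) : Prop :=
  ∃ κ : Cuboid → Fin k, ∀ C ∈ F, ∀ D ∈ F, Cuboid.Touch C D → κ C ≠ κ D

namespace Cuboid

theorem not_collide_of_separated {C D : Cuboid}
    (h : (C.root.1 + C.dims.1 ≤ D.root.1 ∨ D.root.1 + D.dims.1 ≤ C.root.1) ∨
      (C.root.2.1 + C.dims.2.1 ≤ D.root.2.1 ∨ D.root.2.1 + D.dims.2.1 ≤ C.root.2.1) ∨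
      (C.root.2.2 + C.dims.2.2 ≤ D.root.2.2 ∨ D.root.2.2 + D.dims.2.2 ≤ C.root.2.2)) :
    ¬ Collide C D := by
  rintro ⟨p, ⟨h1, h2, h3, h4, h5, h6⟩, h1', h2', h3', h4', h5', h6'⟩
  rcases h with (h | h) | (h | h) | (h | h) <;>
  · have := (Int.cast_le (R := ℝ)).2 h
    push_cast at this
    linarith

/-- Two integer intervals `[l, l + d]` and `[l', l' + d']` that overlap in a segment. -/
def Overlap (l d l' d' : ℤ) : Prop := l < l' + d' ∧ l' < l + d

/-- Two integer intervals `[l, l + d]` and `[l', l' + d']` that share an endpoint. -/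
def Abut (l d l' d' : ℤ) : Prop := l + d = l' ∨ l' + d' = l

theorem Overlap.exists_mem {l d l' d' : ℤ} (h : Overlap l d l' d') (hd : 0 < d) (hd' : 0 < d') :
    ∃ t : ℝ, (¬ ∃ m : ℤ, t = m) ∧ ((l : ℝ) ≤ t ∧ t ≤ l + d) ∧ ((l' : ℝ) ≤ t ∧ t ≤ l' + d') := by
  obtain ⟨h1, h2⟩ := h
  obtain ⟨m, hl, hl', hr, hr'⟩ : ∃ m : ℤ, l ≤ m ∧ l' ≤ m ∧ m + 1 ≤ l + d ∧ m + 1 ≤ l' + d' :=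
    ⟨max l l', by omega, by omega, by omega, by omega⟩
  refine ⟨m + 1 / 2, ?_, ?_⟩
  · rintro ⟨n, hn⟩
    have : (2 * m + 1 : ℝ) = 2 * n := by linarith
    norm_cast at this
    omega
  · have hl := (Int.cast_le (R := ℝ)).2 hl
    have hl' := (Int.cast_le (R := ℝ)).2 hl'
    have hr := (Int.cast_le (R := ℝ)).2 hr
    have hr' := (Int.cast_le (R := ℝ)).2 hr'
    push_cast at hr hr'
    refine ⟨⟨?_, ?_⟩, ?_, ?_⟩ <;> linarith

theorem Abut.exists_mem {l d l' d' : ℤ} (h : Abut l d l' d') (hd : 0 < d) (hd' : 0 < d') :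
    ∃ t : ℝ, ((l : ℝ) ≤ t ∧ t ≤ l + d) ∧ ((l' : ℝ) ≤ t ∧ t ≤ l' + d') := by
  have hd := (Int.cast_lt (R := ℝ)).2 hd
  have hd' := (Int.cast_lt (R := ℝ)).2 hd'
  push_cast at hd hd'
  rcases h with h | h <;> have h := congrArg (Int.cast (R := ℝ)) h <;> push_cast at h
  · exact ⟨l', by constructor <;> linarith, by constructor <;> linarith⟩
  · exact ⟨l, by constructor <;> linarith, by constructor <;> linarith⟩

theorem touch_of_abut {C D : Cuboid} (hC : C.valid) (hD : D.valid)
    (h : (Abut C.root.1 C.dims.1 D.root.1 D.dims.1 ∧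
        Overlap C.root.2.1 C.dims.2.1 D.root.2.1 D.dims.2.1 ∧
        Overlap C.root.2.2 C.dims.2.2 D.root.2.2 D.dims.2.2) ∨
      (Overlap C.root.1 C.dims.1 D.root.1 D.dims.1 ∧
        Abut C.root.2.1 C.dims.2.1 D.root.2.1 D.dims.2.1 ∧
        Overlap C.root.2.2 C.dims.2.2 D.root.2.2 D.dims.2.2) ∨
      (Overlap C.root.1 C.dims.1 D.root.1 D.dims.1 ∧
        Overlap C.root.2.1 C.dims.2.1 D.root.2.1 D.dims.2.1 ∧
        Abut C.root.2.2 C.dims.2.2 D.root.2.2 D.dims.2.2)) :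
    Touch C D := by
  constructor
  · apply not_collide_of_separated
    unfold Abut at h
    omega
  · obtain ⟨c1, c2, c3⟩ := hC
    obtain ⟨d1, d2, d3⟩ := hD
    rcases h with ⟨hx, hy, hz⟩ | ⟨hx, hy, hz⟩ | ⟨hx, hy, hz⟩
    · obtain ⟨x, ⟨hx1, hx2⟩, hx3, hx4⟩ := hx.exists_mem c1 d1
      obtain ⟨y, hy, ⟨hy1, hy2⟩, hy3, hy4⟩ := hy.exists_mem c2 d2
      obtain ⟨z, hz, ⟨hz1, hz2⟩, hz3, hz4⟩ := hz.exists_mem c3 d3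
      exact ⟨(x, y, z), ⟨⟨hx1, hx2, hy1, hy2, hz1, hz2⟩, hx3, hx4, hy3, hy4, hz3, hz4⟩,
        by rintro (h | h | h) <;> tauto⟩
    · obtain ⟨x, hx, ⟨hx1, hx2⟩, hx3, hx4⟩ := hx.exists_mem c1 d1
      obtain ⟨y, ⟨hy1, hy2⟩, hy3, hy4⟩ := hy.exists_mem c2 d2
      obtain ⟨z, hz, ⟨hz1, hz2⟩, hz3, hz4⟩ := hz.exists_mem c3 d3
      exact ⟨(x, y, z), ⟨⟨hx1, hx2, hy1, hy2, hz1, hz2⟩, hx3, hx4, hy3, hy4, hz3, hz4⟩,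
        by rintro (h | h | h) <;> tauto⟩
    · obtain ⟨x, hx, ⟨hx1, hx2⟩, hx3, hx4⟩ := hx.exists_mem c1 d1
      obtain ⟨y, hy, ⟨hy1, hy2⟩, hy3, hy4⟩ := hy.exists_mem c2 d2
      obtain ⟨z, ⟨hz1, hz2⟩, hz3, hz4⟩ := hz.exists_mem c3 d3
      exact ⟨(x, y, z), ⟨⟨hx1, hx2, hy1, hy2, hz1, hz2⟩, hx3, hx4, hy3, hy4, hz3, hz4⟩,
        by rintro (h | h | h) <;> tauto⟩

end Cuboid

/-- Refutation of `k`-colorability of a graph on `ℕ` by depth-first search. The bits of `N[v]` are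
neighbours of `v`; the bits of `ms[c]` are the vertices already barred from color `c`, the colors
`ms.length, …, k - 1` being unused so far. The last list names the vertices to branch on, in
preorder; the unused part of it is returned, or `none` when the search does not succeed. -/
def refute (N : List ℕ) (k : ℕ) : ℕ → List ℕ → List ℕ → Option (List ℕ)
  | 0, _, _ => none
  | _ + 1, _, [] => none
  | f + 1, ms, v :: l =>
    ((List.range ms.length).foldlM (fun l c =>
      if (ms.getD c 0).testBit v then some l
      else refute N k f (ms.set c (ms.getD c 0 ||| N.getD v 0)) l) l).bind fun l =>
        if ms.length < k then refute N k f (ms ++ [N.getD v 0]) l else some l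

theorem exists_eq_some_of_foldlM_eq_some {α β : Type*} {g : β → α → Option β} {xs : List α}
    {b r : β} (h : xs.foldlM g b = some r) {c : α} (hc : c ∈ xs) :
    ∃ l l', g l c = some l' := by
  induction xs generalizing b with
  | nil => simp at hc
  | cons x xs ih =>
    rw [List.foldlM_cons] at h
    obtain ⟨b', hb, h⟩ := Option.bind_eq_some_iff.1 h
    rcases List.mem_cons.1 hc with rfl | hc
    · exact ⟨_, _, hb⟩
    · exact ih h hc

theorem false_of_refute_eq_some {N : List ℕ} {k f : ℕ} {ms l r : List ℕ}
    (h : refute N k f ms l = some r) (κ : ℕ → ℕ) (hk : ∀ x, κ x < k)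
    (hN : ∀ v x, (N.getD v 0).testBit x → κ x ≠ κ v)
    (hm : ∀ c x, (ms.getD c 0).testBit x → κ x ≠ c) : False := by
  induction f generalizing ms l r κ with
  | zero => simp [refute] at h
  | succ f ih =>
    cases l with
    | nil => simp [refute] at h
    | cons v l =>
      rw [refute] at h
      obtain ⟨l₁, h₁, h₂⟩ := Option.bind_eq_some_iff.1 h
      by_cases hv : κ v < ms.length
      · obtain ⟨l₂, l₃, h₃⟩ := exists_eq_some_of_foldlM_eq_some h₁ (List.mem_range.2 hv)
        rw [if_neg fun hb => hm _ _ hb rfl] at h₃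
        refine ih h₃ κ hk hN fun c x hx => ?_
        rcases eq_or_ne c (κ v) with rfl | hc
        · simp only [List.getD_eq_getElem?_getD, List.getElem?_set_self hv, Option.getD_some,
            Nat.testBit_or, Bool.or_eq_true] at hx
          exact hx.elim (fun hx => hm _ _ (by simpa using hx))
            (fun hx => hN _ _ (by simpa using hx))
        · apply hm
          simpa [List.getD_eq_getElem?_getD, List.getElem?_set_ne hc.symm] using hx
      · have hu : ms.length < k := by have := hk v; omega
        rw [if_pos hu] at h₂
        refine ih h₂ (fun x => Equiv.swap ms.length (κ v) (κ x)) (fun x => ?_)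
          (fun v' x hx he => hN v' x hx ((Equiv.injective _) he)) fun c x hx he => ?_
        · have := hk x
          have := hk v
          rw [Equiv.swap_apply_def]
          split_ifs <;> omega
        · rcases lt_trichotomy c ms.length with hc | rfl | hc
          · rw [List.getD_append _ _ _ _ hc] at hx
            apply hm c x hx
            have : κ x = Equiv.swap ms.length (κ v) c := by rw [← he, Equiv.swap_apply_self]
            rw [this, Equiv.swap_apply_of_ne_of_ne] <;> omega
          · rw [List.getD_append_right _ _ _ _ le_rfl] at hx
            simp only [Nat.sub_self, List.getD_cons_zero] at hx
            apply hN _ _ hx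
            apply (Equiv.swap ms.length (κ v)).injective
            rw [Equiv.swap_apply_right]
            exact he
          · rw [List.getD_eq_default] at hx
            · simp at hx
            · simp; omega

/-- The linear form `u.1 + u.2 * a` in a parameter `a`. -/
abbrev LinForm := ℕ × ℕ

namespace LinForm

/-- The value of a linear form. -/
def eval (a : ℕ) (u : LinForm) : ℤ := u.1 + u.2 * a

/-- A sufficient condition for `u ≤ v` at all parameters from `a₀` on. -/
def ble (a₀ : ℕ) (u v : LinForm) : Bool :=
  Nat.ble u.2 v.2 && Nat.ble (u.1 + u.2 * a₀) (v.1 + v.2 * a₀)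

/-- The sum of two linear forms. -/
def add (u v : LinForm) : LinForm := (u.1 + v.1, u.2 + v.2)

theorem eval_add (a : ℕ) (u v : LinForm) : eval a (u.add v) = eval a u + eval a v := by
  simp only [eval, LinForm.add]
  push_cast
  ring

theorem eval_le_of_ble {a₀ a : ℕ} (ha : a₀ ≤ a) {u v : LinForm} (h : ble a₀ u v) :
    eval a u ≤ eval a v := by
  obtain ⟨p, q⟩ := u
  obtain ⟨p', q'⟩ := v
  simp only [ble, Bool.and_eq_true, Nat.ble_eq] at h
  obtain ⟨t, rfl⟩ := Nat.exists_eq_add_of_le ha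
  have h' : p + q * a₀ + q * t ≤ p' + q' * a₀ + q' * t :=
    Nat.add_le_add h.2 (Nat.mul_le_mul_right t h.1)
  simp only [eval, ← Nat.cast_mul, ← Nat.cast_add, Nat.cast_le, Nat.mul_add, ← Nat.add_assoc]
  exact h'

/-- A sufficient condition for `u < v` at all parameters from `a₀` on. -/
def blt (a₀ : ℕ) (u v : LinForm) : Bool := ble a₀ (u.1 + 1, u.2) v

theorem eval_lt_of_blt {a₀ a : ℕ} (ha : a₀ ≤ a) {u v : LinForm} (h : blt a₀ u v) :
    eval a u < eval a v := by
  have := eval_le_of_ble ha h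
  simp only [eval] at this ⊢
  push_cast at this
  linarith

end LinForm

/-- A cuboid of height one with a long and a short horizontal side; the long side is parallel to
the second axis if the brick is turned, to the first one otherwise. -/
structure Brick where
  x : LinForm
  y : LinForm
  z : ℕ
  turned : Bool

/-- The side lengths of the bricks, and a lower bound for the parameter in all linear forms. -/
structure BrickShape where
  long : LinForm
  short : LinForm
  bound : ℕ

namespace Brick

/-- The side parallel to the first axis. -/
def width (P : BrickShape) (b : Brick) : LinForm := bif b.turned then P.short else P.long

/-- The side parallel to the second axis. -/
def depth (P : BrickShape) (b : Brick) : LinForm := bif b.turned then P.long else P.short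

/-- The cuboid of a brick at the parameter `a`. -/
def toCuboid (P : BrickShape) (a : ℕ) (b : Brick) : Cuboid :=
  ⟨(b.x.eval a, b.y.eval a, b.z), ((b.width P).eval a, (b.depth P).eval a, 1)⟩

/-- The interval from `l` of length `d` ends before the one from `l'` of length `d'` starts,
or conversely. -/
def apart (m : ℕ) (l d l' d' : LinForm) : Bool :=
  LinForm.ble m (l.add d) l' || LinForm.ble m (l'.add d') l

/-- The intervals from `l` of length `d` and from `l'` of length `d'` share a segment. -/
def overlap (m : ℕ) (l d l' d' : LinForm) : Bool :=
  LinForm.blt m l (l'.add d') && LinForm.blt m l' (l.add d)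

/-- The intervals from `l` of length `d` and from `l'` of length `d'` share an endpoint. -/
def abut (m : ℕ) (l d l' d' : LinForm) : Bool :=
  (LinForm.ble m (l.add d) l' && LinForm.ble m l' (l.add d)) ||
    (LinForm.ble m (l'.add d') l && LinForm.ble m l (l'.add d'))

/-- Two bricks are separated by a coordinate plane. -/
def separated (P : BrickShape) (b c : Brick) : Bool :=
  apart P.bound b.x (b.width P) c.x (c.width P) ||
    apart P.bound b.y (b.depth P) c.y (c.depth P) ||
    (Nat.blt b.z c.z || Nat.blt c.z b.z)

/-- Two bricks share a rectangle. -/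
def touches (P : BrickShape) (b c : Brick) : Bool :=
  bif Nat.beq b.z c.z then
    abut P.bound b.x (b.width P) c.x (c.width P) &&
      overlap P.bound b.y (b.depth P) c.y (c.depth P) ||
    overlap P.bound b.x (b.width P) c.x (c.width P) &&
      abut P.bound b.y (b.depth P) c.y (c.depth P)
  else (Nat.beq (b.z + 1) c.z || Nat.beq (c.z + 1) b.z) &&
    (overlap P.bound b.x (b.width P) c.x (c.width P) &&
      overlap P.bound b.y (b.depth P) c.y (c.depth P))

variable {P : BrickShape} {a : ℕ} {b c : Brick}

theorem overlap_eval {l d l' d' : LinForm} (ha : P.bound ≤ a) (h : overlap P.bound l d l' d') :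
    Cuboid.Overlap (l.eval a) (d.eval a) (l'.eval a) (d'.eval a) := by
  simp only [overlap, Bool.and_eq_true] at h
  simpa only [Cuboid.Overlap, LinForm.eval_add] using
    And.intro (LinForm.eval_lt_of_blt ha h.1) (LinForm.eval_lt_of_blt ha h.2)

theorem abut_eval {l d l' d' : LinForm} (ha : P.bound ≤ a) (h : abut P.bound l d l' d') :
    Cuboid.Abut (l.eval a) (d.eval a) (l'.eval a) (d'.eval a) := by
  simp only [abut, Bool.or_eq_true, Bool.and_eq_true] at h
  unfold Cuboid.Abut
  simp only [← LinForm.eval_add]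
  exact h.imp
    (fun h => le_antisymm (LinForm.eval_le_of_ble ha h.1) (LinForm.eval_le_of_ble ha h.2))
    (fun h => le_antisymm (LinForm.eval_le_of_ble ha h.1) (LinForm.eval_le_of_ble ha h.2))

theorem apart_eval {l d l' d' : LinForm} (ha : P.bound ≤ a) (h : apart P.bound l d l' d') :
    l.eval a + d.eval a ≤ l'.eval a ∨ l'.eval a + d'.eval a ≤ l.eval a := by
  simp only [apart, Bool.or_eq_true] at h
  simp only [← LinForm.eval_add]
  exact h.imp (LinForm.eval_le_of_ble ha) (LinForm.eval_le_of_ble ha)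

theorem valid_toCuboid (hl : 0 < P.long.eval a) (hs : 0 < P.short.eval a) :
    (b.toCuboid P a).valid := by
  unfold toCuboid Cuboid.valid width depth
  cases b.turned <;> simp [hl, hs]

theorem not_collide_of_separated (ha : P.bound ≤ a) (h : separated P b c) :
    ¬ Cuboid.Collide (b.toCuboid P a) (c.toCuboid P a) := by
  apply Cuboid.not_collide_of_separated
  simp only [separated, Bool.or_eq_true, Nat.blt_eq] at h
  rcases h with (h | h) | h
  · exact .inl (apart_eval ha h)
  · exact .inr (.inl (apart_eval ha h))
  · simp only [toCuboid]
    omega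

theorem touch_of_touches (ha : P.bound ≤ a) (hl : 0 < P.long.eval a) (hs : 0 < P.short.eval a)
    (h : touches P b c) : Cuboid.Touch (b.toCuboid P a) (c.toCuboid P a) := by
  apply Cuboid.touch_of_abut (valid_toCuboid hl hs) (valid_toCuboid hl hs)
  unfold touches at h
  cases hz : Nat.beq b.z c.z
  · simp only [hz, cond_false, Bool.and_eq_true, Bool.or_eq_true, Nat.beq_eq] at h
    refine .inr (.inr ⟨overlap_eval ha h.2.1, overlap_eval ha h.2.2, ?_⟩)
    simp only [toCuboid, Cuboid.Abut]
    omega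
  · simp only [hz, cond_true, Bool.or_eq_true, Bool.and_eq_true] at h
    have hz' : Cuboid.Overlap b.z 1 c.z 1 := by
      have := Nat.eq_of_beq_eq_true hz
      unfold Cuboid.Overlap
      omega
    rcases h with h | h
    · exact .inl ⟨abut_eval ha h.1, overlap_eval ha h.2, hz'⟩
    · exact .inr (.inl ⟨overlap_eval ha h.1, abut_eval ha h.2, hz'⟩)

instance : Std.Symm fun b c => separated P b c := by
  refine ⟨fun b c h => ?_⟩
  simp only [separated, apart, Bool.or_eq_true] at h ⊢
  tauto

/-- The set of the bricks of a list that touch `b`, as a bit mask. -/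
def mask (P : BrickShape) (b : Brick) : List Brick → ℕ
  | [] => 0
  | c :: l => Nat.bit (touches P b c) (mask P b l)

theorem exists_touches_of_testBit_mask {l : List Brick} {x : ℕ} (h : (mask P b l).testBit x) :
    ∃ hx : x < l.length, touches P b l[x] := by
  induction l generalizing x with
  | nil => simp [mask] at h
  | cons c l ih =>
    cases x with
    | zero =>
      rw [mask, Nat.testBit_bit_zero] at h
      exact ⟨by simp, h⟩
    | succ x =>
      rw [mask, Nat.testBit_bit_succ] at h
      obtain ⟨hx, h⟩ := ih h
      exact ⟨by simpa using hx, h⟩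

/-- A list of pairwise separated bricks whose contact graph is refuted to be `k`-colorable gives a
configuration without proper `k`-coloring. -/
theorem exists_config {k f : ℕ} {bs : List Brick} {N l : List ℕ} {A B : ℕ}
    (ha : P.bound ≤ a) (hA : P.long.eval a = A) (hB : P.short.eval a = B)
    (hA0 : 0 < A) (hB0 : 0 < B) (hk : 0 < k)
    (hsep : bs.Pairwise fun b c => separated P b c)
    (hN : (bs.map fun b => mask P b bs) = N) (hr : (refute N k f [] l).isSome) :
    ∃ F : Finset Cuboid, IsConfig F ∧ Type2 A B 1 F ∧ ¬ ProperColoring k F := by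
  classical
  have hl : 0 < P.long.eval a := by omega
  have hs : 0 < P.short.eval a := by omega
  refine ⟨(bs.map (toCuboid P a)).toFinset, ⟨?_, ?_⟩, ?_, ?_⟩
  · intro C hC
    obtain ⟨b, -, rfl⟩ := List.mem_map.1 (List.mem_toFinset.1 hC)
    exact valid_toCuboid hl hs
  · intro C hC D hD hCD
    obtain ⟨b, hb, rfl⟩ := List.mem_map.1 (List.mem_toFinset.1 hC)
    obtain ⟨c, hc, rfl⟩ := List.mem_map.1 (List.mem_toFinset.1 hD)
    exact not_collide_of_separated ha
      (hsep.forall hb hc (fun h => hCD (h ▸ rfl)))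
  · intro C hC
    obtain ⟨b, -, rfl⟩ := List.mem_map.1 (List.mem_toFinset.1 hC)
    unfold toCuboid width depth
    cases b.turned <;> simp [hA, hB]
  · rintro ⟨κ, hκ⟩
    obtain ⟨r, hr⟩ := Option.isSome_iff_exists.1 hr
    refine false_of_refute_eq_some hr
      (fun i => if h : i < bs.length then (κ (bs[i].toCuboid P a)).val else 0) (fun x => ?_)
      (fun v x hx => ?_) (fun c x hx => by simp at hx)
    · split_ifs
      · exact Fin.isLt _
      · exact hk
    · by_cases hv : v < bs.length
      · rw [← hN, List.getD_eq_getElem _ _ (by simpa using hv), List.getElem_map] at hx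
        obtain ⟨hx', ht⟩ := exists_touches_of_testBit_mask hx
        simp only [hv, hx', dif_pos]
        refine fun he => hκ _ ?_ _ ?_ (touch_of_touches ha hl hs ht) (Fin.ext he.symm)
        · exact List.mem_toFinset.2 (List.mem_map_of_mem (List.getElem_mem _))
        · exact List.mem_toFinset.2 (List.mem_map_of_mem (List.getElem_mem _))
      · rw [List.getD_eq_default] at hx
        · simp at hx
        · rw [← hN]
          simpa using hv

end Brick

namespace Brick

/-- The shape of the bricks in `domino`. -/
def dominoShape : BrickShape := ⟨(2, 0), (1, 0), 0⟩

/-- Dominoes whose contact graph is not 4-colorable. -/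
def domino : List Brick := [
    ⟨(5, 0), (5, 0), 0, true⟩, ⟨(4, 0), (7, 0), 3, true⟩, ⟨(7, 0), (3, 0), 1, false⟩,
    ⟨(1, 0), (2, 0), 1, true⟩, ⟨(5, 0), (4, 0), 0, false⟩, ⟨(5, 0), (4, 0), 2, true⟩,
    ⟨(8, 0), (4, 0), 1, true⟩, ⟨(6, 0), (5, 0), 0, true⟩, ⟨(8, 0), (6, 0), 2, false⟩,
    ⟨(6, 0), (5, 0), 2, true⟩, ⟨(3, 0), (4, 0), 1, false⟩, ⟨(4, 0), (3, 0), 0, false⟩,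
    ⟨(2, 0), (1, 0), 0, false⟩, ⟨(3, 0), (3, 0), 2, true⟩, ⟨(5, 0), (6, 0), 1, false⟩,
    ⟨(5, 0), (3, 0), 1, true⟩, ⟨(6, 0), (5, 0), 1, false⟩, ⟨(4, 0), (4, 0), 3, false⟩,
    ⟨(6, 0), (6, 0), 4, true⟩, ⟨(6, 0), (3, 0), 2, false⟩, ⟨(3, 0), (5, 0), 2, true⟩,
    ⟨(6, 0), (4, 0), 2, false⟩, ⟨(2, 0), (5, 0), 4, false⟩, ⟨(9, 0), (3, 0), 3, true⟩,
    ⟨(7, 0), (2, 0), 4, false⟩, ⟨(5, 0), (2, 0), 2, false⟩, ⟨(6, 0), (3, 0), 3, true⟩,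
    ⟨(1, 0), (4, 0), 2, true⟩, ⟨(3, 0), (3, 0), 1, false⟩, ⟨(5, 0), (1, 0), 1, false⟩,
    ⟨(7, 0), (2, 0), 2, false⟩, ⟨(5, 0), (4, 0), 4, false⟩, ⟨(9, 0), (2, 0), 2, true⟩,
    ⟨(3, 0), (3, 0), 0, true⟩, ⟨(4, 0), (1, 0), 0, true⟩, ⟨(7, 0), (6, 0), 2, true⟩,
    ⟨(8, 0), (3, 0), 4, false⟩, ⟨(3, 0), (0, 0), 2, true⟩, ⟨(3, 0), (5, 0), 0, true⟩,
    ⟨(5, 0), (7, 0), 3, true⟩, ⟨(4, 0), (4, 0), 0, true⟩, ⟨(4, 0), (7, 0), 1, false⟩,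
    ⟨(8, 0), (7, 0), 1, false⟩, ⟨(7, 0), (3, 0), 4, true⟩, ⟨(6, 0), (2, 0), 1, true⟩,
    ⟨(4, 0), (6, 0), 2, false⟩, ⟨(7, 0), (6, 0), 0, true⟩, ⟨(6, 0), (7, 0), 3, false⟩,
    ⟨(1, 0), (4, 0), 1, false⟩, ⟨(6, 0), (2, 0), 3, false⟩, ⟨(1, 0), (1, 0), 0, true⟩,
    ⟨(2, 0), (6, 0), 2, true⟩, ⟨(8, 0), (7, 0), 0, true⟩, ⟨(3, 0), (6, 0), 1, false⟩,
    ⟨(1, 0), (5, 0), 1, true⟩, ⟨(2, 0), (2, 0), 3, false⟩, ⟨(3, 0), (1, 0), 1, true⟩,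
    ⟨(6, 0), (7, 0), 1, false⟩, ⟨(1, 0), (6, 0), 0, false⟩, ⟨(4, 0), (3, 0), 2, false⟩,
    ⟨(3, 0), (2, 0), 2, false⟩, ⟨(2, 0), (1, 0), 2, true⟩, ⟨(9, 0), (3, 0), 1, true⟩,
    ⟨(4, 0), (1, 0), 2, false⟩, ⟨(6, 0), (1, 0), 2, false⟩, ⟨(3, 0), (7, 0), 2, false⟩,
    ⟨(8, 0), (2, 0), 3, false⟩, ⟨(7, 0), (6, 0), 1, false⟩, ⟨(5, 0), (1, 0), 3, false⟩,
    ⟨(1, 0), (3, 0), 0, false⟩, ⟨(8, 0), (3, 0), 2, true⟩, ⟨(2, 0), (4, 0), 2, true⟩,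
    ⟨(2, 0), (7, 0), 1, false⟩, ⟨(0, 0), (2, 0), 2, false⟩, ⟨(4, 0), (8, 0), 2, false⟩,
    ⟨(7, 0), (2, 0), 0, false⟩, ⟨(5, 0), (2, 0), 0, false⟩, ⟨(5, 0), (7, 0), 0, false⟩,
    ⟨(9, 0), (4, 0), 2, true⟩, ⟨(5, 0), (2, 0), 3, true⟩, ⟨(1, 0), (2, 0), 3, true⟩,
    ⟨(3, 0), (4, 0), 3, true⟩, ⟨(1, 0), (1, 0), 1, false⟩, ⟨(4, 0), (4, 0), 4, true⟩,
    ⟨(9, 0), (4, 0), 4, true⟩, ⟨(8, 0), (4, 0), 4, true⟩, ⟨(2, 0), (2, 0), 1, true⟩,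
    ⟨(1, 0), (4, 0), 0, true⟩, ⟨(4, 0), (6, 0), 0, true⟩, ⟨(8, 0), (5, 0), 3, false⟩,
    ⟨(7, 0), (1, 0), 1, true⟩, ⟨(3, 0), (3, 0), 4, true⟩, ⟨(4, 0), (4, 0), 2, true⟩,
    ⟨(5, 0), (5, 0), 4, false⟩, ⟨(4, 0), (5, 0), 3, false⟩, ⟨(9, 0), (2, 0), 0, true⟩,
    ⟨(4, 0), (0, 0), 1, true⟩, ⟨(5, 0), (7, 0), 2, false⟩, ⟨(8, 0), (2, 0), 1, false⟩,
    ⟨(2, 0), (2, 0), 0, false⟩, ⟨(1, 0), (5, 0), 3, false⟩, ⟨(8, 0), (5, 0), 0, true⟩,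
    ⟨(9, 0), (5, 0), 1, true⟩, ⟨(4, 0), (5, 0), 1, false⟩, ⟨(2, 0), (4, 0), 0, true⟩,
    ⟨(4, 0), (3, 0), 4, false⟩, ⟨(6, 0), (2, 0), 4, true⟩, ⟨(6, 0), (5, 0), 3, false⟩,
    ⟨(2, 0), (5, 0), 1, false⟩, ⟨(7, 0), (3, 0), 3, false⟩, ⟨(6, 0), (3, 0), 0, false⟩,
    ⟨(7, 0), (4, 0), 0, true⟩, ⟨(7, 0), (5, 0), 4, true⟩, ⟨(7, 0), (4, 0), 3, false⟩,
    ⟨(1, 0), (3, 0), 2, false⟩, ⟨(3, 0), (6, 0), 3, false⟩, ⟨(4, 0), (2, 0), 1, false⟩,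
    ⟨(9, 0), (6, 0), 0, true⟩, ⟨(5, 0), (6, 0), 3, false⟩, ⟨(9, 0), (4, 0), 0, true⟩,
    ⟨(8, 0), (3, 0), 0, true⟩, ⟨(6, 0), (4, 0), 1, false⟩, ⟨(7, 0), (5, 0), 2, false⟩,
    ⟨(7, 0), (6, 0), 3, false⟩, ⟨(6, 0), (1, 0), 0, false⟩, ⟨(3, 0), (3, 0), 3, false⟩,
    ⟨(4, 0), (1, 0), 3, true⟩, ⟨(2, 0), (3, 0), 3, true⟩]

/-- The neighbourhoods in the contact graph of `domino`. -/
def dominoMask : List ℕ := [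
    10141514437951384009970508906640, 41538374868297547387664146389532672,
    3988982379719972607164608782023524416, 20769187516356301278100242076532736,
    2662350214213732866529013092319266945, 10165963602612119313408285901312,
    9304603576398013812480317727696814084, 2596148429418529541787445555707921,
    15950741020021693766792146991506784256, 5649381399819046701733281990023659552,
    334664710220409703798812589465600, 1298074214709264770859663955623952,
    633830135817466342776175067136, 42556065057505627615129321964236178432,
    10141204801973562324334028063361, 2741542882511190814275792380211760176,
    7977974264343564624646272173148750528, 42535295889888802439735385035502518304,
    337499305708284110137665198080655360, 649037107318034621665375118426116,
    41862898376117454623801250282479616, 7985752568426566073271524071819444768,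
    1270138569564996308338248515584, 11033631463001646709031534090780672,
    81129638414680469243898609270784, 83076749737161734366374166543204352,
    11277019740234791666084938406035456, 20770455084741899945060790328885248,
    83076749813928495160342563380046848, 21350724762761313789737252476946481152,
    318150591369168634689316454400, 121704370813630862511712258621440,
    316912953547502537063228506112, 20916234904356080936428966513664,
    83077462790095428299252197486499840, 15950736107875315651092568425692660480,
    649037165345292795077308545236992, 12754194144713244672, 344801272747088515790855504658432,
    332307157402572886220699168227196930, 10141514286835656557325818268689,
    158765965913490565488854450176, 166158570075515544753153246727503872,
    16307057360021569248521794508292096, 2742830816759038291920340875704041476,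
    373845537222592811826887369063154208, 2598683730619133723091447597498496,
    10966131123681880979985084018516557824, 344801195378196964471738281755656,
    730166746336291979950891015864320, 633830136407688969623756083208, 7120443212451887972352,
    166156034774314940571853642732142592, 334660067949984749860726290530304,
    324518708400931925967541645606912, 297747071055822364459731160645792432128,
    83077462872226827322242709357334528, 158456476291830156605584850944,
    20282564346156599111155001065472, 42535295870069672554126075848064278560,
    85153668479971173120113902126110875648, 20769187516355712169832947552092160,
    664619425021892395013932349489414212, 85070591809462778694855560347164606464,
    1237940343656657492750893056, 158456348640363378718524047362,
    649037107316853454129267388448768, 7605903601369520598969445597504,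
    85070591730235220356424138233047154688, 20916467017523152259405643251720,
    5327945613964352231780759208485978180, 170162278434107629697160143628850438144,
    36904749345510785024, 20769187435348238639579623705280520, 158456325065422163884262817794,
    22598174360322950457610478009018482688, 21352022756509882694356414096362964992,
    309485009965532824568070273, 5316917054361035609378831105525809408,
    127605928160171131397831254563126116352, 170161952647903380486970420237510377472,
    212718018990388339221003620060381716480, 77371254834362770339663880,
    40597005648324760735044031610880, 657655645870358339768025088,
    15576891213917315642124558045020160, 20769821264275720581273687569727496,
    20282409604242272760555594842112, 151115736462601314369537,
    15961282802471220014262543151720824832, 21267648249471341820896887963329232900,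
    42535336429948604494458820115224854528, 10161011842454977792308688331808,
    5354575952076076114923508270891008, 374007647958706532238296904250818592,
    1993842310590061649956609940185415680, 83076749736557251351917589876965376,
    18926503713519075066368, 40852059079961098052628905988, 77371842824330145601425408,
    170141183460471651944509774409194536960, 2162591641579755854861478279168131136,
    830767497365874804205426076119204160, 324523505418583877312554383557665,
    324518708401522221778183684882432, 42535376997241878487641006617906905088,
    40564819207303341419642780385280, 16298619869270354888449044712517534208,
    30423614407838716180703319426048, 10384593717070909636229819749892096,
    1331824144214296623513678772116129812, 3988984596870581782077427167073992848,
    10633986235498362137104567189129920512, 811297041802893278945674673520640,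
    170141183460547823718184304795700961288, 332307018755687448431300606178623490,
    79228238073353060216716951552, 664621603796059305832820508033286144,
    10675524620231475446188352900889313792, 1495389140775712988137046738233982976,
    668510795451678549696136149727182916, 2596148429267413814282840352850004,
    162259896102645052606124526732096, 337661555700563028860704748707250432,
    1238053376080969146921123840, 255211815758001957294604090140386271232,
    42535295865117912701391860761391792128, 42556066320205676610343463530356801536]

/-- The branching vertices in a refutation of colorability of `domino`. -/
def dominoBranch : List ℕ := [
    0, 4, 7, 14, 16, 111, 121, 6, 2, 110, 120, 9, 122, 15, 44, 5, 21, 19, 70, 45, 103, 40, 10,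
    92, 103, 40, 5, 21, 45, 53, 92, 10, 20, 13, 59, 19, 28, 33, 11, 38, 44, 25, 70, 30, 88, 41,
    77, 46, 57, 67, 101, 108, 104, 110, 76, 120, 75, 17, 26, 94, 109, 113, 107, 89, 23, 32, 62,
    98, 26, 49, 79, 94, 125, 81, 115, 118, 107, 113, 109, 23, 32, 66, 78, 89, 123, 8, 35, 97,
    47, 39, 65, 1, 74, 102, 42, 52, 117, 66, 32, 62, 98, 21, 70, 19, 44, 110, 11, 120, 101, 67,
    10, 92, 45, 53, 108, 20, 13, 28, 33, 59, 116, 76, 34, 75, 90, 29, 96, 56, 60, 25, 30, 98,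
    28, 33, 122, 70, 21, 19, 5, 15, 45, 59, 92, 103, 40, 10, 13, 28, 11, 28, 33, 28, 33, 45,
    103, 15, 40, 10, 92, 67, 2, 110, 120, 101, 46, 77, 57, 41, 88, 9, 122, 35, 8, 70, 78, 97,
    102, 42, 52, 117, 35, 97, 9, 122, 8, 35, 57, 46, 77, 41, 88, 97, 101, 102, 42, 52, 117, 35,
    57, 77, 46, 97, 101, 15, 44, 5, 11, 40, 88, 41, 53, 45, 103, 10, 28, 33, 38, 59, 13, 19, 21,
    25, 60, 70, 30, 78, 32, 62, 92, 98, 90, 64, 29, 63, 102, 42, 108, 110, 76, 75, 95, 116, 120,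
    124, 17, 79, 68, 94, 125, 81, 115, 20, 65, 118, 47, 39, 1, 74, 26, 94, 107, 89, 23, 109, 40,
    88, 103, 10, 28, 33, 38, 59, 13, 92, 116, 60, 25, 19, 70, 21, 78, 62, 102, 42, 17, 26, 79,
    49, 109, 94, 107, 89, 118, 123, 47, 18, 112, 93, 83, 31, 26, 79, 49, 109, 93, 83, 31, 26,
    79, 49, 109, 21, 19, 70, 44, 103, 40, 88, 41, 53, 45, 5, 92, 110, 11, 120, 10, 108, 20, 13,
    28, 33, 38, 59, 65, 116, 76, 34, 75, 17, 81, 94, 115, 118, 47, 39, 1, 74, 94, 81, 125, 28,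
    33, 15, 44, 5, 21, 19, 70, 45, 103, 40, 10, 92, 44, 103, 40, 110, 11, 120, 101, 46, 57, 77,
    88, 41, 53, 5, 21, 45, 97, 35, 65, 122, 70, 8, 78, 102, 42, 62, 32, 119, 95, 75, 76, 90, 30,
    19, 25, 59, 78, 102, 42, 62, 32, 98, 119, 95, 75, 76, 90, 30, 116, 25, 19, 28, 59, 21, 70,
    19, 122, 35, 8, 78, 62, 102, 42, 119, 95, 75, 76, 90, 98, 30, 25, 116, 103, 40, 111, 121, 6,
    67, 2, 9, 5, 21, 70, 19, 44, 15, 10, 11, 110, 15, 10, 11, 21, 28, 33, 44, 110, 122, 8, 35,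
    57, 97, 10, 15, 44, 5, 21, 19, 70, 92, 45, 53, 41, 65, 88, 77, 46, 101, 108, 20, 13, 28, 11,
    33, 59, 116, 120, 110, 76, 34, 17, 81, 94, 115, 118, 107, 125, 1, 39, 74, 39, 74, 94, 81,
    125, 11, 15, 28, 33, 33, 28, 15, 44, 110, 35, 57, 46, 77, 110, 11, 15, 120, 101, 46, 77, 57,
    41, 88, 5, 9, 45, 53, 38, 33, 10, 28, 59, 92, 9, 21, 10, 92, 45, 13, 20, 28, 33, 53, 59,
    108, 17, 94, 81, 115, 118, 107, 26, 19, 44, 70, 122, 81, 125, 28, 33, 38, 53, 59, 108, 20,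
    71, 48, 104, 17, 94, 19, 26, 44, 70, 116, 25, 30, 49, 79, 26, 70, 107, 118, 115, 81, 122,
    125, 79, 25, 44, 60, 116, 56, 86, 99, 34, 12, 69, 3, 82, 30, 49, 94, 19, 26, 44, 70, 109,
    113, 116, 25, 30, 60, 79, 49, 66, 32, 122, 35, 8, 78, 70, 122, 25, 44, 60, 79, 116, 56, 86,
    99, 34, 12, 69, 3, 82, 30, 60, 79, 26, 49, 109, 66, 113, 23, 78, 32, 62, 98, 28, 33, 122,
    35, 8, 70, 78, 97, 102, 42, 62, 119, 95, 75, 98, 32, 30, 90, 117, 52, 10, 92, 45, 53, 65,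
    108, 20, 13, 28, 33, 59, 19, 25, 44, 60, 116, 29, 56, 76, 34, 96, 28, 33, 2, 9, 122, 70, 21,
    5, 15, 10, 11, 19, 28, 33, 45, 59, 92, 13, 110, 44, 76, 116, 120, 75, 101, 46, 77, 17, 94,
    20, 25, 30, 60, 26, 109, 113, 23, 32, 62, 98, 29, 31, 32, 66, 49, 78, 79, 89, 106, 24, 36,
    43, 84, 85, 62, 98, 43, 36, 83, 93, 107, 112, 118, 123, 89, 78, 32, 62, 98, 64, 90, 49, 79,
    60, 56, 26, 79, 49, 109, 107, 118, 115, 81, 125, 79, 29, 96, 34, 30, 49, 109, 113, 23, 32,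
    62, 98, 66, 32, 78, 89, 49, 64, 63, 68, 126, 90, 124, 53, 108, 94, 107, 118, 122, 10, 15,
    44, 5, 45, 53, 92, 20, 13, 59, 19, 21, 25, 28, 33, 11, 38, 60, 70, 30, 88, 41, 77, 46, 101,
    67, 57, 108, 104, 116, 76, 34, 110, 120, 17, 26, 94, 107, 109, 113, 89, 23, 32, 62, 98, 79,
    94, 125, 81, 115, 118, 107, 113, 26, 49, 109, 23, 66, 32, 62, 98, 32, 66, 78, 89, 123, 8,
    102, 42, 52, 117, 35, 97, 65, 72, 102, 62, 98, 90, 29, 64, 63, 96, 21, 19, 70, 11, 15, 28,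
    33, 33, 28, 15, 110, 44, 76, 116, 120, 75, 101, 46, 77, 5, 21, 19, 59, 21, 45, 92, 110, 120,
    16, 111, 121, 6, 67, 101, 46, 57, 77, 120, 110, 2, 44, 9, 35, 97, 41, 45, 53, 88, 122, 35,
    8, 97, 102, 42, 117, 52, 119, 11, 40, 76, 75, 15, 116, 5, 21, 19, 70, 10, 28, 33, 103, 92,
    13, 45, 20, 53, 108, 103, 92, 45, 13, 28, 59, 19, 21, 25, 60, 56, 70, 30, 78, 17, 79, 49,
    26, 94, 109, 113, 89, 23, 32, 66, 26, 94, 107, 113, 20, 28, 33, 53, 59, 19, 21, 25, 65, 70,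
    30, 78, 108, 17, 79, 125, 26, 94, 81, 107, 113, 5, 21, 45, 19, 70, 78, 25, 59, 28, 116, 30,
    26, 49, 79, 17, 59, 92, 109, 113, 89, 23, 32, 62, 98, 59, 28, 33, 10, 13, 92, 21, 19, 70,
    15, 40, 76, 88, 41, 53, 38, 45, 5, 65, 103, 10, 108, 20, 116, 19, 21, 25, 59, 28, 13, 60,
    25, 59, 28, 13, 60, 70, 21, 71, 48, 51, 92, 104, 33, 17, 26, 79, 49, 109, 81, 94, 115, 2,
    110, 120, 9, 122, 70, 11, 15, 44, 76, 75, 5, 21, 19, 45, 59, 28, 92, 13, 10, 20, 33, 40,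
    103, 45, 103, 53, 92, 20, 10, 13, 28, 59, 108, 71, 17, 81, 94, 115, 118, 107, 125, 127, 100,
    19, 25, 30, 60, 79, 49, 26, 21, 109, 113, 22, 91, 83, 93, 31, 43, 105, 106, 24, 112, 18, 85,
    123, 47, 23, 36, 84, 89, 32, 66, 83, 91, 105, 21, 25, 30, 79, 49, 26, 109, 113, 89, 23, 32,
    66, 94, 81, 125, 13, 28, 59, 15, 40, 103, 10, 5, 45, 92, 21, 19, 59, 28, 13, 92, 45, 53,
    108, 17, 94, 20, 25, 30, 26, 49, 79, 125, 81, 115, 118, 107, 31, 83, 93, 83, 93, 79, 49,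
    107, 109, 66, 32, 78, 23, 89, 30, 44, 116, 81, 115, 26, 94, 107, 44, 76, 75, 90, 30, 25, 59,
    28, 13, 60, 116, 122, 70, 11, 15, 44, 19, 21, 5, 45, 76, 75, 103, 40, 53, 88, 38, 41, 92,
    20, 108, 10, 13, 28, 33, 59, 25, 60, 71, 104, 48, 116, 56, 17, 81, 94, 115, 118, 107, 125,
    127, 55, 100, 27, 114, 61, 80, 73, 3, 69, 86, 26, 79, 125, 13, 28, 33, 15, 40, 103, 5, 10,
    21, 19, 44, 59, 25, 28, 13, 92, 44, 76, 75, 90, 98, 30, 25, 32, 59, 28, 13, 60, 116, 9, 122,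
    70, 21, 19, 5, 15, 44, 45, 59, 25, 30, 92, 110, 11, 28, 13, 10, 20, 33, 40, 103, 45, 103,
    53, 92, 20, 10, 13, 15, 28, 44, 59, 108, 71, 110, 11, 116, 120, 17, 26, 81, 94, 109, 113,
    115, 118, 107, 125, 127, 100, 22, 91, 83, 31, 93, 83, 31, 93, 26, 94, 81, 125, 13, 40, 59,
    28, 15, 11, 44, 25, 88, 38, 33, 41, 77, 108, 71, 104, 110, 76, 116, 60, 120, 75, 17, 26, 94,
    109, 49, 79, 113, 125, 81, 115, 118, 107, 23, 66, 30, 32, 62, 98, 66, 78, 89, 26, 94, 107,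
    118, 115, 81, 125, 79, 29, 90, 124, 63, 64, 30, 49, 109, 113, 23, 66, 32, 78, 89, 32, 62,
    98, 122, 15, 44, 5, 45, 103, 40, 10, 11, 28, 33, 53, 38, 88, 21, 19, 70, 44, 110, 11, 120,
    5, 21, 19, 45, 59, 25, 28, 70, 30, 116, 76, 34, 75, 10, 13, 92, 20, 53, 103, 108, 17, 26,
    49, 79, 94, 81, 115, 118, 107, 125, 79, 49, 26, 109, 66, 32, 78, 62, 89, 23, 98, 90, 29, 64,
    63, 68, 126, 33, 40, 103, 45, 103, 40, 53, 88, 38, 41, 92, 20, 108, 10, 13, 28, 33, 59, 71,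
    104, 48, 116, 76, 34, 75, 17, 81, 94, 115, 118, 107, 125, 127, 100, 27, 114, 3, 69, 86, 69,
    86, 94, 81, 125, 13, 28, 33, 103, 40, 9, 5, 45, 10, 15, 92, 11, 13, 20, 28, 33, 53, 59, 88,
    38, 41, 108, 71, 48, 104, 17, 94, 81, 115, 118, 107, 125, 21, 26, 19, 79, 113, 70, 122, 26,
    19, 113, 70, 122, 81, 125, 28, 33, 59, 17, 94, 20, 53, 38, 88, 41, 108, 71, 48, 104, 21,
    121, 111, 110, 44, 2, 19, 122, 6, 67, 57, 35, 97, 19, 26, 70, 2, 44, 121, 26, 107, 118, 115,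
    81, 125, 79, 2, 44, 25, 49, 30, 70, 44, 70, 109, 49, 113, 116, 121, 23, 89, 78, 8, 67, 57,
    35, 97, 35, 97, 57, 65, 51, 72, 66, 32, 78, 53, 38, 81, 88, 41, 77, 97, 65, 108, 71, 104,
    115, 125, 127, 100, 21, 121, 111, 110, 44, 2, 19, 122, 35, 6, 67, 57, 46, 70, 19, 2, 26,
    101, 107, 110, 111, 118, 120, 121, 8, 78, 102, 42, 62, 32, 30, 25, 44, 60, 55, 98, 90, 64,
    63, 126, 78, 89, 102, 42, 62, 32, 23, 30, 66, 98, 90, 113, 109, 49, 79, 25, 44, 60, 55, 64,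
    29, 116, 56, 96, 34, 76, 75, 124, 8, 67, 57, 46, 101, 102, 42, 52, 117, 19, 26, 70, 2, 44,
    121, 26, 107, 118, 2, 44, 25, 60, 70, 30, 49, 79, 44, 70, 78, 89, 109, 23, 113, 94, 20, 53,
    38, 88, 41, 108, 71, 48, 104, 21, 121, 111, 110, 44, 2, 19, 122, 6, 67, 57, 35, 97, 19, 26,
    70, 2, 44, 121, 2, 44, 25, 60, 70, 30, 79, 26, 49, 109, 66, 113, 23, 78, 32, 62, 89, 98, 90,
    64, 107, 118, 115, 81, 121, 125, 8, 67, 102, 35, 97, 57, 65, 51, 72, 44, 70, 116, 121, 25,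
    30, 60, 56, 79, 86, 69, 3, 82, 50, 12, 99, 30, 60, 79, 26, 49, 125, 81, 115, 118, 107, 27,
    54, 114, 86, 3, 56, 61, 82, 114, 86, 3, 56, 61, 82, 53, 38, 81, 115, 28, 33, 11, 15, 28, 33,
    33, 28, 15, 59, 13, 92, 20, 53, 108, 71, 48, 17, 94, 81, 115, 125, 79, 127, 100, 27, 114,
    86, 3, 69, 99, 104, 38, 87, 58, 88, 41, 77, 97, 65, 51, 72, 21, 26, 107, 122, 121, 122, 35,
    6, 67, 57, 46, 70, 2, 19, 25, 44, 2, 19, 70, 19, 70, 81, 94, 115, 15, 10, 11, 28, 33, 92,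
    13, 59, 17, 94, 20, 45, 53, 108, 71, 48, 104, 38, 88, 41, 77, 21, 27, 54, 58, 87, 114, 86,
    3, 69, 46, 57, 67, 35, 97, 57, 67, 6, 101, 111, 110, 2, 44, 116, 56, 76, 34, 82, 12, 50, 44,
    70, 19, 76, 116, 25, 56, 60, 82, 61, 37, 63, 99, 12, 34, 50, 120, 75, 121, 122, 26, 79, 49,
    109, 107, 118, 115, 81, 125, 79, 126, 68, 49, 30, 64, 101, 111, 110, 121, 2, 44, 76, 116,
    25, 19, 56, 60, 61, 82, 121, 111, 46, 57, 67, 6, 101, 110, 122, 35, 8, 70, 2, 44, 76, 78,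
    97, 65, 107, 89, 113, 23, 26, 19, 109, 116, 25, 30, 60, 118, 115, 81, 120, 75, 123, 47, 125,
    18, 27, 54, 58, 87, 114, 86, 3, 56, 61, 82, 27, 54, 58, 87, 114, 86, 3, 56, 61, 82, 81, 108,
    53, 38, 88, 94, 20, 45, 53, 108, 71, 48, 104, 38, 88, 41, 77, 118, 107, 115, 81, 122, 125,
    79, 6, 67, 35, 8, 123, 67, 46, 57, 81, 108, 53, 38, 88, 10, 15, 5, 45, 53, 92, 20, 13, 28,
    59, 45, 53, 88, 38, 41, 92, 20, 13, 28, 11, 33, 59, 108, 71, 104, 48, 17, 81, 94, 115, 118,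
    125, 127, 100, 27, 114, 3, 69, 86, 69, 86, 94, 81, 125, 11, 15, 28, 33, 33, 28, 15, 5, 45,
    53, 38, 88, 92, 13, 45, 20, 53, 108]

theorem domino_separated : domino.Pairwise fun b c => separated dominoShape b c := by
  decide +kernel

theorem map_mask_domino :
    (domino.map fun b => mask dominoShape b domino) = dominoMask := by
  decide +kernel

theorem refute_domino : (refute dominoMask 4 129 [] dominoBranch).isSome := by
  decide +kernel

/-- The shape of the bricks in `threeUp`. -/
def threeUpShape : BrickShape := ⟨(0, 1), (1, 0), 3⟩

/-- Bricks of length at least three whose contact graph is not 4-colorable. -/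
def threeUp : List Brick := [
    ⟨(0, 1), (1, 1), 1, false⟩, ⟨(0, 1), (2, 1), 1, false⟩, ⟨(2, 0), (0, 1), 1, false⟩,
    ⟨(1, 1), (1, 1), 2, true⟩, ⟨(2, 1), (1, 1), 2, true⟩, ⟨(0, 1), (3, 1), 1, false⟩,
    ⟨(0, 1), (2, 0), 2, true⟩, ⟨(1, 1), (0, 1), 0, true⟩, ⟨(0, 1), (2, 1), 2, true⟩,
    ⟨(0, 1), (0, 1), 0, true⟩]

/-- The neighbourhoods in the contact graph of `threeUp`. -/
def threeUpMask : List ℕ := [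
    734, 953, 705, 371, 43, 282, 269, 519, 106, 135]

/-- The branching vertices in a refutation of colorability of `threeUp`. -/
def threeUpBranch : List ℕ := [
    0, 1, 3, 4, 5, 8, 6, 2, 7, 9, 7, 9]

theorem threeUp_separated : threeUp.Pairwise fun b c => separated threeUpShape b c := by
  decide +kernel

theorem map_mask_threeUp :
    (threeUp.map fun b => mask threeUpShape b threeUp) = threeUpMask := by
  decide +kernel

theorem refute_threeUp : (refute threeUpMask 4 11 [] threeUpBranch).isSome := by
  decide +kernel

/-- The shape of the bricks in `five`. -/
def fiveShape : BrickShape := ⟨(5, 0), (1, 0), 0⟩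

/-- Bricks of length five whose contact graph is not 5-colorable. -/
def five : List Brick := [
    ⟨(4, 0), (3, 0), 1, true⟩, ⟨(4, 0), (11, 0), 2, false⟩, ⟨(7, 0), (4, 0), 1, true⟩,
    ⟨(2, 0), (7, 0), 2, false⟩, ⟨(8, 0), (5, 0), 1, true⟩, ⟨(2, 0), (9, 0), 2, false⟩,
    ⟨(0, 0), (7, 0), 0, false⟩, ⟨(7, 0), (9, 0), 1, true⟩, ⟨(9, 0), (8, 0), 1, true⟩,
    ⟨(3, 0), (8, 0), 2, false⟩, ⟨(5, 0), (7, 0), 1, true⟩, ⟨(3, 0), (5, 0), 1, true⟩,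
    ⟨(3, 0), (5, 0), 2, false⟩, ⟨(5, 0), (12, 0), 0, false⟩, ⟨(4, 0), (8, 0), 0, false⟩,
    ⟨(11, 0), (5, 0), 1, true⟩, ⟨(8, 0), (9, 0), 3, true⟩, ⟨(3, 0), (13, 0), 2, false⟩,
    ⟨(1, 0), (6, 0), 2, false⟩, ⟨(6, 0), (9, 0), 1, true⟩, ⟨(8, 0), (4, 0), 3, true⟩,
    ⟨(6, 0), (7, 0), 3, true⟩, ⟨(7, 0), (8, 0), 3, true⟩, ⟨(6, 0), (4, 0), 1, true⟩,
    ⟨(6, 0), (2, 0), 3, true⟩, ⟨(4, 0), (8, 0), 1, true⟩, ⟨(3, 0), (6, 0), 0, false⟩,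
    ⟨(8, 0), (5, 0), 0, false⟩, ⟨(3, 0), (6, 0), 3, true⟩, ⟨(0, 0), (9, 0), 0, false⟩,
    ⟨(2, 0), (7, 0), 1, true⟩, ⟨(8, 0), (8, 0), 2, false⟩, ⟨(7, 0), (7, 0), 2, false⟩,
    ⟨(4, 0), (5, 0), 3, true⟩, ⟨(5, 0), (12, 0), 1, true⟩, ⟨(10, 0), (6, 0), 3, true⟩,
    ⟨(6, 0), (6, 0), 2, false⟩, ⟨(5, 0), (7, 0), 0, false⟩, ⟨(5, 0), (3, 0), 2, false⟩,
    ⟨(3, 0), (10, 0), 1, true⟩, ⟨(8, 0), (5, 0), 2, false⟩, ⟨(7, 0), (11, 0), 0, false⟩,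
    ⟨(3, 0), (10, 0), 2, false⟩, ⟨(8, 0), (0, 0), 1, true⟩, ⟨(10, 0), (5, 0), 1, true⟩,
    ⟨(9, 0), (5, 0), 3, true⟩, ⟨(5, 0), (2, 0), 1, true⟩, ⟨(5, 0), (10, 0), 3, true⟩,
    ⟨(4, 0), (10, 0), 3, true⟩, ⟨(7, 0), (3, 0), 3, true⟩, ⟨(9, 0), (8, 0), 0, false⟩,
    ⟨(3, 0), (10, 0), 0, false⟩, ⟨(5, 0), (5, 0), 3, true⟩, ⟨(8, 0), (10, 0), 1, true⟩,
    ⟨(4, 0), (12, 0), 2, false⟩, ⟨(9, 0), (3, 0), 1, true⟩, ⟨(8, 0), (10, 0), 2, false⟩,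
    ⟨(9, 0), (6, 0), 0, false⟩, ⟨(5, 0), (9, 0), 0, false⟩, ⟨(4, 0), (4, 0), 2, false⟩,
    ⟨(3, 0), (5, 0), 0, false⟩, ⟨(2, 0), (11, 0), 0, false⟩, ⟨(7, 0), (9, 0), 2, false⟩]

/-- The neighbourhoods in the contact graph of `five`. -/
def fiveMask : List ℕ := [
    1729452625755380808, 99505802354164864, 1729391263532208784, 4503682584677889,
    4944962499192570244, 4616194026069560832, 138579822593, 4929196389227438102,
    5018155678154366992, 4616189633403817004, 2596400106631086635, 1152922056074203753,
    581598847474862085, 2314852424672084352, 289356414076322900, 4756945804684427264,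
    4701793195352129538, 18437177910755456, 4574045949401097, 2614343998923482274,
    577060061306748928, 5211685136630314, 4630267764940014082, 1729452831880533516,
    581527645483700224, 2326114173055946275, 1152992010798368837, 1333083081887744016,
    285881613419048, 290482177072711680, 2305843559506380904, 4611738833641308944,
    36644628758299164, 4785074872783400, 18014398543700992, 4683778871999332352,
    36645661723332636, 181269885077177428, 613131664129785856, 2308099208181319680,
    612542394601082896, 2317102008282128768, 4684166374995002530, 612489824200294420,
    4792957078236856576, 4611687227461795840, 1729382531863942145, 22803871162302466,
    18159542902849538, 576461100219895808, 288248105776759040, 2594076134715425920,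
    140746097431080, 90074191570674066, 9429428938145922, 144143161332072720,
    4620697650088444162, 36046526778212352, 3377700257940880, 643489206374405, 70368953894917,
    2254549700584448, 72114805154087856]

/-- The branching vertices in a refutation of colorability of `five`. -/
def fiveBranch : List ℕ := [
    0, 3, 10, 9, 23, 46, 12, 59, 2, 11, 18, 33, 52, 18, 26, 60, 59, 2, 11, 18, 26, 60, 18, 33,
    52, 12, 59, 2, 14, 37, 26, 60, 4, 32, 36, 49, 20, 24, 21, 22, 31, 45, 35, 62, 32, 36, 40,
    55, 37, 4, 32, 36, 49, 20, 24, 21, 22, 31, 45, 35, 62, 32, 36, 40, 55, 43, 38, 24, 49, 18,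
    11, 33, 52, 11, 18, 12, 46, 23, 2, 36, 32, 59, 49, 20, 24, 21, 22, 38, 52, 1, 25, 42, 19, 7,
    47, 4, 14, 58, 14, 58, 42, 5, 19, 7, 25, 33, 28, 47, 48, 36, 32, 4, 14, 37, 14, 37, 23, 36,
    2, 46, 14, 37, 4, 6, 26, 32, 60, 25, 5, 33, 52, 19, 58, 29, 30, 51, 7, 62, 31, 8, 44, 15,
    40, 55, 42, 1, 7, 21, 22, 62, 5, 33, 52, 19, 42, 1, 7, 54, 34, 17, 62, 22, 16, 21, 56, 8,
    31, 55, 40, 20, 45, 53, 13, 41, 61, 58, 29, 51, 58, 29, 51, 7, 62, 8, 31, 50, 44, 15, 27,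
    55, 55, 40, 44, 50, 15, 31, 59, 13, 61, 39, 41, 42, 53, 1, 54, 17, 34, 53, 41, 61, 25, 37,
    4, 6, 26, 32, 55, 40, 44, 59, 60, 5, 33, 52, 15, 31, 62, 27, 57, 12, 46, 23, 2, 36, 59, 24,
    49, 21, 38, 52, 33, 5, 25, 28, 14, 4, 32, 40, 55, 32, 20, 22, 31, 62, 6, 26, 37, 26, 37, 49,
    21, 32, 38, 52, 5, 25, 33, 28, 42, 19, 1, 7, 4, 40, 55, 7, 4, 14, 58, 26, 60, 26, 60, 46,
    23, 36, 2, 14, 37, 4, 6, 26, 32, 60, 25, 5, 28, 33, 19, 58, 29, 30, 51, 7, 62, 31, 8, 44,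
    15, 55, 27, 57, 42, 1, 7, 21, 22, 62, 5, 28, 33, 19, 42, 1, 28, 33, 52, 21, 22, 47, 48, 54,
    34, 17, 7, 62, 58, 29, 51, 7, 62, 8, 31, 50, 44, 15, 27, 55, 55, 40, 44, 50, 59, 13, 61, 39,
    41, 42, 53, 1, 54, 17, 34, 53, 41, 61, 25, 37, 4, 6, 26, 32, 55, 40, 59, 60, 5, 28, 33, 19,
    58, 29, 30, 51, 7, 39, 61, 42, 1, 7, 21, 22, 62, 26, 60, 26, 60, 25, 5, 18, 28, 33, 12, 46,
    23, 2, 36, 32, 59, 49, 20, 21, 22, 1, 42, 14, 36, 32, 4, 37, 33, 52]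

theorem five_separated : five.Pairwise fun b c => separated fiveShape b c := by
  decide +kernel

theorem map_mask_five :
    (five.map fun b => mask fiveShape b five) = fiveMask := by
  decide +kernel

theorem refute_five : (refute fiveMask 5 64 [] fiveBranch).isSome := by
  decide +kernel

/-- The shape of the bricks in `sixUp`. -/
def sixUpShape : BrickShape := ⟨(0, 1), (1, 0), 6⟩

/-- Bricks of length at least six whose contact graph is not 5-colorable. -/
def sixUp : List Brick := [
    ⟨(4, 1), (1, 1), 1, true⟩, ⟨(1, 1), (0, 1), 2, false⟩, ⟨(0, 1), (4, 0), 1, true⟩,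
    ⟨(0, 1), (2, 1), 0, false⟩, ⟨(3, 1), (3, 1), 1, true⟩, ⟨(3, 0), (3, 1), 0, false⟩,
    ⟨(3, 0), (2, 1), 2, false⟩, ⟨(5, 1), (0, 1), 1, true⟩, ⟨(2, 1), (0, 1), 1, true⟩,
    ⟨(0, 1), (1, 1), 0, false⟩, ⟨(2, 1), (1, 1), 2, false⟩, ⟨(3, 0), (4, 1), 0, false⟩,
    ⟨(3, 1), (3, 0), 1, true⟩, ⟨(6, 1), (5, 0), 1, true⟩, ⟨(3, 1), (3, 1), 0, false⟩,
    ⟨(0, 1), (4, 1), 1, true⟩, ⟨(5, 0), (5, 0), 1, true⟩, ⟨(1, 1), (1, 1), 1, true⟩,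
    ⟨(4, 0), (5, 0), 1, true⟩, ⟨(4, 0), (4, 1), 2, false⟩, ⟨(3, 1), (2, 1), 2, false⟩,
    ⟨(1, 1), (0, 1), 0, false⟩, ⟨(0, 1), (5, 1), 0, false⟩, ⟨(4, 1), (1, 0), 1, true⟩,
    ⟨(5, 0), (6, 1), 0, false⟩, ⟨(0, 1), (3, 1), 2, false⟩, ⟨(3, 1), (4, 1), 0, false⟩,
    ⟨(2, 0), (1, 1), 2, false⟩]

/-- The neighbourhoods in the contact graph of `sixUp`. -/
def sixUpMask : List ℕ := [
    131094168, 142620032, 167936616, 152485, 122179841, 477452, 169280772, 116418059, 40509050,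
    2232717, 135279043, 71794976, 11536155, 70272130, 67117241, 21628932, 135006304, 189303660,
    134809696, 34046224, 33567937, 8401792, 84052369, 2101379, 4358161, 1704405, 4221073, 459846]

/-- The branching vertices in a refutation of colorability of `sixUp`. -/
def sixUpBranch : List ℕ := [
    0, 3, 7, 9, 12, 8, 14, 4, 26, 22, 5, 11, 17, 2, 15, 24, 17, 2, 11, 15, 24, 26, 22, 5, 11,
    17, 11, 17, 4, 26, 22, 17, 5, 11, 24, 15, 2, 25, 6, 19, 20, 10, 27, 16, 18, 26, 22, 17, 5,
    11, 4, 22, 25, 26, 14, 5, 17, 2, 11, 15, 19, 17, 2, 11, 15, 19, 14, 22, 26, 8, 21, 23, 1,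
    10, 20, 6, 17, 2, 27, 17, 2, 27, 4, 10, 20, 25, 6, 17, 20, 1, 13, 14, 26, 23, 6, 17, 2, 27,
    17, 2, 27, 14, 26, 22, 17, 5, 11]

theorem sixUp_separated : sixUp.Pairwise fun b c => separated sixUpShape b c := by
  decide +kernel

theorem map_mask_sixUp :
    (sixUp.map fun b => mask sixUpShape b sixUp) = sixUpMask := by
  decide +kernel

theorem refute_sixUp : (refute sixUpMask 5 29 [] sixUpBranch).isSome := by
  decide +kernel

/-- The shape of the bricks in `fourTwo`. -/
def fourTwoShape : BrickShape := ⟨(4, 0), (2, 0), 0⟩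

/-- Bricks of dimensions four, two, one whose contact graph is not 5-colorable. -/
def fourTwo : List Brick := [
    ⟨(6, 0), (5, 0), 0, false⟩, ⟨(5, 0), (6, 0), 1, true⟩, ⟨(7, 0), (8, 0), 1, true⟩,
    ⟨(2, 0), (5, 0), 0, false⟩, ⟨(3, 0), (4, 0), 1, true⟩, ⟨(3, 0), (8, 0), 1, true⟩,
    ⟨(6, 0), (9, 0), 0, false⟩, ⟨(7, 0), (4, 0), 1, true⟩, ⟨(7, 0), (0, 0), 1, true⟩,
    ⟨(4, 0), (5, 0), 2, false⟩, ⟨(8, 0), (7, 0), 0, false⟩, ⟨(9, 0), (6, 0), 1, true⟩,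
    ⟨(4, 0), (9, 0), 2, false⟩, ⟨(1, 0), (6, 0), 1, true⟩, ⟨(0, 0), (7, 0), 0, false⟩,
    ⟨(2, 0), (9, 0), 0, false⟩, ⟨(9, 0), (2, 0), 1, true⟩, ⟨(3, 0), (0, 0), 1, true⟩,
    ⟨(0, 0), (5, 0), 2, false⟩, ⟨(2, 0), (7, 0), 2, false⟩, ⟨(4, 0), (1, 0), 2, false⟩,
    ⟨(2, 0), (1, 0), 0, true⟩, ⟨(4, 0), (7, 0), 0, false⟩, ⟨(1, 0), (2, 0), 1, true⟩,
    ⟨(6, 0), (7, 0), 2, false⟩, ⟨(6, 0), (3, 0), 2, false⟩, ⟨(5, 0), (2, 0), 1, true⟩,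
    ⟨(8, 0), (1, 0), 0, true⟩, ⟨(5, 0), (10, 0), 1, true⟩, ⟨(8, 0), (5, 0), 2, false⟩,
    ⟨(4, 0), (3, 0), 0, false⟩, ⟨(2, 0), (3, 0), 2, false⟩]

/-- The neighbourhoods in the contact graph of `fourTwo`. -/
def fourTwoMask : List ℕ := [
    1279331466, 357077757, 289414338, 1155555347, 3303957034, 273215506, 272665606, 1866534663,
    1309737088, 2802581650, 4196549, 553714885, 285736998, 9224248, 4235320, 272654434,
    704645505, 3299868688, 2156405264, 17052210, 2248278272, 1082261528, 50431, 2149982232,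
    537401990, 2752578432, 3255960475, 1073807745, 36966, 50399872, 203555225, 110494224]

/-- The branching vertices in a refutation of colorability of `fourTwo`. -/
def fourTwoBranch : List ℕ := [
    0, 1, 3, 22, 4, 5, 7, 2, 6, 9, 19, 24, 19, 24, 10, 11, 15, 24, 9, 19, 10, 11, 24, 12, 19, 9,
    26, 28, 6, 15, 14, 13, 16, 25, 8, 27, 29, 30, 17, 20, 31, 21, 23, 18, 31, 29, 25, 8, 27, 30,
    27, 30, 26, 9, 30, 2, 24, 12, 19, 10, 11, 24, 29, 16, 8, 25, 14, 13, 19, 7, 2, 12, 24, 9,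
    26, 28, 6, 10, 11, 15, 16, 25, 29, 18, 23, 31, 17, 21, 30, 21, 30, 23, 31, 17, 21, 30, 27,
    8, 20, 25, 10, 11, 24, 12, 6, 15, 28, 15, 28, 9, 26, 26, 30, 5, 14, 13, 19, 9, 18, 23, 17,
    31, 7, 9, 19, 24, 2, 12, 2, 6, 10, 11, 24, 9, 19, 12, 28, 29, 16, 25, 15, 14, 13, 19, 9, 18,
    23, 31, 10, 11, 24, 9, 19, 12, 29, 16, 8, 25]

theorem fourTwo_separated : fourTwo.Pairwise fun b c => separated fourTwoShape b c := by
  decide +kernel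

theorem map_mask_fourTwo :
    (fourTwo.map fun b => mask fourTwoShape b fourTwo) = fourTwoMask := by
  decide +kernel

theorem refute_fourTwo : (refute fourTwoMask 5 33 [] fourTwoBranch).isSome := by
  decide +kernel

end Brick

/-- Lower bounds for type-2 configurations: (i) for `a ≥ 2` some type-2 configuration of
`[a,1,1]` needs more than 4 colors; (ii) for `a ≥ 5` some type-2 configuration of `[a,1,1]`
needs more than 5 colors; (iii) some type-2 configuration of `[4,2,1]` needs more than
5 colors. -/
theorem type2_lower_bounds :
    (∀ a : ℕ, 2 ≤ a →
      ∃ F : Finset Cuboid, IsConfig F ∧ Type2 a 1 1 F ∧ ¬ ProperColoring 4 F) ∧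
    (∀ a : ℕ, 5 ≤ a →
      ∃ F : Finset Cuboid, IsConfig F ∧ Type2 a 1 1 F ∧ ¬ ProperColoring 5 F) ∧
    (∃ F : Finset Cuboid, IsConfig F ∧ Type2 4 2 1 F ∧ ¬ ProperColoring 5 F) := by
  refine ⟨fun a ha => ?_, fun a ha => ?_, ?_⟩
  · rcases ha.eq_or_lt with rfl | ha
    · exact Brick.exists_config (a := 0) (Nat.zero_le _) rfl rfl (by simp) (by simp) (by simp)
        Brick.domino_separated Brick.map_mask_domino Brick.refute_domino
    · exact Brick.exists_config (P := Brick.threeUpShape) ha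
        (by simp [LinForm.eval, Brick.threeUpShape]) (by simp [LinForm.eval, Brick.threeUpShape])
        (by omega) (by simp) (by simp)
        Brick.threeUp_separated Brick.map_mask_threeUp Brick.refute_threeUp
  · rcases ha.eq_or_lt with rfl | ha
    · exact Brick.exists_config (a := 0) (Nat.zero_le _) rfl rfl (by simp) (by simp) (by simp)
        Brick.five_separated Brick.map_mask_five Brick.refute_five
    · exact Brick.exists_config (P := Brick.sixUpShape) ha
        (by simp [LinForm.eval, Brick.sixUpShape]) (by simp [LinForm.eval, Brick.sixUpShape])
        (by omega) (by simp) (by simp)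
        Brick.sixUp_separated Brick.map_mask_sixUp Brick.refute_sixUp
  · exact Brick.exists_config (a := 0) (Nat.zero_le _) rfl rfl (by simp) (by simp) (by simp)
      Brick.fourTwo_separated Brick.map_mask_fourTwo Brick.refute_fourTwo
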